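/- arXiv:q-alg/9707008 — 8 statements merged into one kernel-verified Lean document; each statement's English description precedes it below -/
import Mathlib

section
/- Let n be a natural number and let C be an 𝔽₂-linear subspace of (ZMod 2)^n. Then for every vector v ∈ (ZMod 2)^n, the signed sum ∑_{u ∈ C} (−1)^{⟨u,v⟩} (an integer, where ⟨u,v⟩ denotes the number of indices i with u i = 1 and v i = 1) equals |C| if v lies in the annihilator code C⊥, and equals 0 otherwise. Equivalently, the characteristic function of C⊥ equals (1/|C|) times the n-fold Hadamard transform μ^{⊗n} applied to the characteristic function of C. -/
/-- Over `𝔽₂`, the dot product is the parity of the number of common ones. -/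
theorem natCast_card_common_ones_eq_dotProduct {ι : Type*} [Fintype ι] (u v : ι → ZMod 2)
    [DecidablePred fun i => u i = 1 ∧ v i = 1] :
    ((Finset.univ.filter fun i => u i = 1 ∧ v i = 1).card : ZMod 2) = ∑ i, u i * v i := by
  rw [Finset.natCast_card_filter]
  refine Finset.sum_congr rfl fun i _ => ?_
  have h : ∀ a b : ZMod 2, a * b = if a = 1 ∧ b = 1 then 1 else 0 := by decide
  rw [h]
  congr

/-- The sign `(-1) ^ k` only depends on the class of `k` modulo two. -/
theorem neg_one_pow_eq_ite_natCast_zmod_two (k : ℕ) :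
    (-1 : ℤ) ^ k = if (k : ZMod 2) = 0 then 1 else -1 := by
  simp only [ZMod.natCast_eq_zero_iff_even]
  split_ifs with h
  · exact h.neg_one_pow
  · exact (Nat.not_even_iff_odd.mp h).neg_one_pow

open scoped Classical in
/-- For a binary linear code `C ≤ 𝔽₂ⁿ`, the signed character sum
`∑_{u ∈ C} (−1)^{⟨u,v⟩}` equals `|C|` if `v ∈ C⊥` and `0` otherwise. -/
theorem stmt_0 (n : ℕ) (C : Submodule (ZMod 2) (Fin n → ZMod 2)) (v : Fin n → ZMod 2) :
    (∑ u : C, (-1 : ℤ) ^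
        (Finset.univ.filter fun i => (u : Fin n → ZMod 2) i = 1 ∧ v i = 1).card) =
      if (∀ c ∈ C, ∑ i, c i * v i = 0) then (Nat.card C : ℤ) else 0 := by
  simp only [neg_one_pow_eq_ite_natCast_zmod_two, natCast_card_common_ones_eq_dotProduct]
  split_ifs with h
  · rw [Finset.sum_congr rfl fun (u : C) _ => if_pos (h u u.2)]
    simp
  · push Not at h
    obtain ⟨c, hc, hcv⟩ := h
    have flip : ∀ a b : ZMod 2, b ≠ 0 →
        (if a + b = 0 then (1 : ℤ) else -1) = -(if a = 0 then 1 else -1) := by decide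
    have translate := Equiv.sum_comp (Equiv.addRight (⟨c, hc⟩ : C))
      fun u : C => if ∑ i, (u : Fin n → ZMod 2) i * v i = 0 then (1 : ℤ) else -1
    simp only [Equiv.coe_addRight, Submodule.coe_add, Pi.add_apply, add_mul,
      Finset.sum_add_distrib, flip _ _ hcv, Finset.sum_neg_distrib] at translate
    linarith
end

section
/- The automorphism group Aut(H₈) of the Hamming code H₈ acts on the 105 markings of the coordinate set {1,…,8}, and this action has exactly three orbits, of sizes 7, 42 and 56. Representatives of the three orbits are the markings {{1,2},{3,4},{5,6},{7,8}}, {{1,2},{3,4},{5,7},{6,8}} and {{1,2},{3,5},{4,7},{6,8}}. -/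
/-- The Hamming code `H₈ ≤ 𝔽₂⁸`. -/
def H8 : Submodule (ZMod 2) (Fin 8 → ZMod 2) :=
  Submodule.span (ZMod 2)
    {![0,0,0,0,1,1,1,1], ![0,0,1,1,0,0,1,1], ![0,1,0,1,0,1,0,1], ![1,1,1,1,1,1,1,1]}

/-- A coordinate permutation is an automorphism of `H₈` if it preserves the code. -/
def IsAutH8 (σ : Equiv.Perm (Fin 8)) : Prop := ∀ c ∈ H8, c ∘ ⇑σ ∈ H8

/-- A marking: a partition of the 8 coordinates into four 2-element sets. -/
def IsMarking (M : Finset (Finset (Fin 8))) : Prop :=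
  (∀ p ∈ M, p.card = 2) ∧ (∀ i : Fin 8, ∃ p ∈ M, i ∈ p) ∧
    (M : Set (Finset (Fin 8))).PairwiseDisjoint id

/-- The action of a coordinate permutation on a marking. -/
def markAct (σ : Equiv.Perm (Fin 8)) (M : Finset (Finset (Fin 8))) :
    Finset (Finset (Fin 8)) :=
  M.image (Finset.image σ)

/-- `M` lies in the `Aut(H₈)`-orbit of `N`. -/
def InOrbit (M N : Finset (Finset (Fin 8))) : Prop :=
  ∃ σ : Equiv.Perm (Fin 8), IsAutH8 σ ∧ M = markAct σ N

def M1 : Finset (Finset (Fin 8)) := {{0,1},{2,3},{4,5},{6,7}}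
def M2 : Finset (Finset (Fin 8)) := {{0,1},{2,3},{4,6},{5,7}}
def M3 : Finset (Finset (Fin 8)) := {{0,1},{2,4},{3,6},{5,7}}

open Finset

namespace HammingMarkings

/-! ### Automorphisms of `H₈` as affine permutations

Identifying `Fin 8` with `𝔽₂³` by binary expansion, `H₈` is the space of affine functions. -/

/-- Four points of `Fin 8 = 𝔽₂³` with zero sum. -/
def IsQuad (i j k l : Fin 8) : Prop := i ^^^ j ^^^ k ^^^ l = 0

instance (i j k l : Fin 8) : Decidable (IsQuad i j k l) :=
  inferInstanceAs (Decidable (_ = _))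

theorem xor_assoc : ∀ a b c : Fin 8, a ^^^ b ^^^ c = a ^^^ (b ^^^ c) := by decide +kernel

theorem xor_comm : ∀ a b : Fin 8, a ^^^ b = b ^^^ a := by decide +kernel

theorem xor_eq_zero : ∀ a b : Fin 8, a ^^^ b = 0 ↔ a = b := by decide +kernel

theorem isQuad_iff (i j k l : Fin 8) : IsQuad i j k l ↔ l = i ^^^ j ^^^ k := by
  rw [IsQuad, xor_eq_zero, eq_comm]

/-- The `b`-th generator of `H₈`. -/
def generator : Fin 4 → Fin 8 → ZMod 2 :=
  ![![0,0,0,0,1,1,1,1], ![0,0,1,1,0,0,1,1], ![0,1,0,1,0,1,0,1], ![1,1,1,1,1,1,1,1]]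

theorem H8_eq_span_range : H8 = Submodule.span (ZMod 2) (Set.range generator) := by
  rw [H8]
  congr 1
  ext v
  constructor
  · rintro (rfl | rfl | rfl | rfl)
    exacts [⟨0, rfl⟩, ⟨1, rfl⟩, ⟨2, rfl⟩, ⟨3, rfl⟩]
  · rintro ⟨b, rfl⟩
    fin_cases b
    exacts [.inl rfl, .inr (.inl rfl), .inr (.inr (.inl rfl)), .inr (.inr (.inr rfl))]

theorem generator_quad : ∀ b : Fin 4, ∀ i j k : Fin 8,
    generator b i + generator b j + generator b k + generator b (i ^^^ j ^^^ k) = 0 := by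
  decide +kernel

theorem generator_separates : ∀ i j : Fin 8, (∀ b, generator b i = generator b j) → i = j := by
  decide +kernel

theorem eq_sum_generator_of_quad (v : Fin 8 → ZMod 2)
    (hv : ∀ i j k l, IsQuad i j k l → v i + v j + v k + v l = 0) :
    v = ∑ b, ![v 4 + v 0, v 2 + v 0, v 1 + v 0, v 0] b • generator b := by
  have h3 := hv 0 1 2 3 (by decide)
  have h5 := hv 0 1 4 5 (by decide)
  have h6 := hv 0 2 4 6 (by decide)
  have h7 := hv 1 2 4 7 (by decide)
  have hdouble : ∀ x : ZMod 2, x + x = 0 := by decide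
  funext i
  fin_cases i <;> simp [generator, Fin.sum_univ_four] <;> grind

theorem mem_H8_iff_quad (v : Fin 8 → ZMod 2) :
    v ∈ H8 ↔ ∀ i j k l, IsQuad i j k l → v i + v j + v k + v l = 0 := by
  rw [H8_eq_span_range]
  constructor
  · intro hv i j k l hq
    rw [isQuad_iff] at hq
    subst hq
    induction hv using Submodule.span_induction with
    | mem v hv =>
      obtain ⟨b, rfl⟩ := hv
      exact generator_quad b i j k
    | zero => simp
    | add v w _ _ hv hw =>
      simp only [Pi.add_apply]
      linear_combination hv + hw
    | smul a v _ hv =>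
      simp only [Pi.smul_apply, smul_eq_mul]
      linear_combination a * hv
  · intro hv
    rw [eq_sum_generator_of_quad v hv]
    exact Submodule.sum_mem _ fun b _ =>
      Submodule.smul_mem _ _ (Submodule.subset_span (Set.mem_range_self b))

theorem isQuad_iff_H8 (i j k l : Fin 8) :
    IsQuad i j k l ↔ ∀ c ∈ H8, c i + c j + c k + c l = 0 := by
  refine ⟨fun h c hc => (mem_H8_iff_quad c).1 hc i j k l h, fun h => ?_⟩
  rw [isQuad_iff]
  refine generator_separates _ _ fun b => ?_
  have hb : generator b ∈ H8 :=
    H8_eq_span_range ▸ Submodule.subset_span (Set.mem_range_self b)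
  exact add_left_cancel ((h _ hb).trans (generator_quad b i j k).symm)

theorem isAutH8_iff (σ : Equiv.Perm (Fin 8)) :
    IsAutH8 σ ↔ ∀ i j k l, IsQuad i j k l → IsQuad (σ i) (σ j) (σ k) (σ l) := by
  constructor
  · intro h i j k l hq
    rw [isQuad_iff_H8]
    exact fun c hc => (mem_H8_iff_quad _).1 (h c hc) i j k l hq
  · intro h c hc
    rw [mem_H8_iff_quad] at hc ⊢
    exact fun i j k l hq => hc _ _ _ _ (h i j k l hq)

theorem isQuad_map_iff {σ : Equiv.Perm (Fin 8)} (hσ : IsAutH8 σ) (i j k l : Fin 8) :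
    IsQuad (σ i) (σ j) (σ k) (σ l) ↔ IsQuad i j k l := by
  rw [isAutH8_iff] at hσ
  refine ⟨fun h => ?_, hσ i j k l⟩
  have h' := hσ i j k _ ((isQuad_iff i j k _).2 rfl)
  rw [isQuad_iff] at h h' ⊢
  exact σ.injective (h.trans h'.symm)

/-- The linear map `𝔽₂³ → 𝔽₂³` sending the standard basis `1, 2, 4` to `x, y, z`. -/
def linMap (x y z i : Fin 8) : Fin 8 :=
  (if i.val.testBit 0 then x else 0) ^^^ (if i.val.testBit 1 then y else 0) ^^^
    (if i.val.testBit 2 then z else 0)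

theorem testBit_xor : ∀ b : Fin 3, ∀ i j : Fin 8,
    (i ^^^ j).val.testBit b = (i.val.testBit b ^^ j.val.testBit b) := by
  decide +kernel

theorem ite_testBit_xor (b : Fin 3) (x i j : Fin 8) :
    (if (i ^^^ j).val.testBit b then x else 0) =
      (if i.val.testBit b then x else 0) ^^^ (if j.val.testBit b then x else 0) := by
  rw [testBit_xor]
  generalize i.val.testBit b = p, j.val.testBit b = q
  revert p q x
  decide +kernel

theorem linMap_xor (x y z i j : Fin 8) :
    linMap x y z (i ^^^ j) = linMap x y z i ^^^ linMap x y z j := by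
  have : Std.Associative (α := Fin 8) (· ^^^ ·) := ⟨xor_assoc⟩
  have : Std.Commutative (α := Fin 8) (· ^^^ ·) := ⟨xor_comm⟩
  have h0 := ite_testBit_xor 0 x i j
  have h1 := ite_testBit_xor 1 y i j
  have h2 := ite_testBit_xor 2 z i j
  simp only [Fin.val_zero, Fin.val_one, Fin.val_two] at h0 h1 h2
  rw [linMap, h0, h1, h2, linMap, linMap]
  ac_rfl

theorem isAutH8_of_linMap {σ : Equiv.Perm (Fin 8)} {x y z : Fin 8}
    (h : ∀ i, σ i = linMap x y z i) : IsAutH8 σ := by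
  rw [isAutH8_iff]
  intro i j k l hq
  rw [isQuad_iff] at hq ⊢
  rw [hq, h, h, h, h, linMap_xor, linMap_xor]

/-! ### Markings as fixed-point-free involutions -/

/-- The partner functions of markings. -/
def IsMatching (f : Fin 8 → Fin 8) : Prop := (∀ i, f i ≠ i) ∧ ∀ i, f (f i) = i

/-- The set of pairs `{i, f i}`. -/
def pairs (f : Fin 8 → Fin 8) : Finset (Finset (Fin 8)) := univ.image fun i => {i, f i}

theorem pairs_injOn : Set.InjOn pairs {f | IsMatching f} := by
  rintro f ⟨-, -⟩ g ⟨-, hg⟩ h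
  funext i
  have hi : ({i, f i} : Finset (Fin 8)) ∈ pairs g := h ▸ mem_image_of_mem _ (mem_univ i)
  obtain ⟨j, -, hj⟩ := mem_image.1 hi
  have h1 : i ∈ ({j, g j} : Finset (Fin 8)) := hj ▸ by simp
  have h2 : f i ∈ ({j, g j} : Finset (Fin 8)) := hj ▸ by simp
  have h3 : g j ∈ ({i, f i} : Finset (Fin 8)) := hj ▸ by simp
  have h4 : j ∈ ({i, f i} : Finset (Fin 8)) := hj ▸ by simp
  have h5 := hg j
  simp only [mem_insert, mem_singleton] at h1 h2 h3 h4
  grind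

theorem exists_pairs_eq {M : Finset (Finset (Fin 8))} (hM : IsMarking M) :
    ∃ f, IsMatching f ∧ M = pairs f := by
  obtain ⟨hcard, hcover, hdisj⟩ := hM
  have huniq : ∀ p ∈ M, ∀ q ∈ M, ∀ i, i ∈ p → i ∈ q → p = q := fun p hp q hq i hip hiq =>
    hdisj.elim_finset hp hq i hip hiq
  have hpartner : ∀ i : Fin 8, ∃ j, j ≠ i ∧ ({i, j} : Finset (Fin 8)) ∈ M := by
    intro i
    obtain ⟨p, hp, hi⟩ := hcover i
    obtain ⟨a, b, hab, rfl⟩ := card_eq_two.1 (hcard p hp)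
    rcases mem_insert.1 hi with rfl | hi
    · exact ⟨b, hab.symm, hp⟩
    · obtain rfl := mem_singleton.1 hi
      exact ⟨a, hab, pair_comm a i ▸ hp⟩
  choose f hne hmem using hpartner
  refine ⟨f, ⟨hne, fun i => ?_⟩, ?_⟩
  · have h := huniq _ (hmem (f i)) _ (hmem i) (f i) (by simp) (by simp)
    have hi : f (f i) ∈ ({i, f i} : Finset (Fin 8)) := h ▸ by simp
    simpa [hne] using hi
  · ext p
    constructor
    · intro hp
      obtain ⟨i, hi⟩ := card_pos.1 (by rw [hcard p hp]; norm_num)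
      exact mem_image.2 ⟨i, mem_univ i, huniq _ (hmem i) _ hp i (by simp) hi⟩
    · intro hp
      obtain ⟨i, -, rfl⟩ := mem_image.1 hp
      exact hmem i

theorem markAct_pairs (σ : Equiv.Perm (Fin 8)) (f : Fin 8 → Fin 8) :
    markAct σ (pairs f) = pairs (σ ∘ f ∘ σ.symm) := by
  ext p
  simp only [markAct, pairs, mem_image, mem_univ, true_and, exists_exists_eq_and]
  rw [σ.exists_congr_left]
  simp [image_insert]

theorem IsMatching.conj {f : Fin 8 → Fin 8} (hf : IsMatching f) (σ : Equiv.Perm (Fin 8)) :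
    IsMatching (σ ∘ f ∘ σ.symm) := by
  refine ⟨fun i h => hf.1 (σ.symm i) ?_, fun i => ?_⟩
  · exact σ.injective (by simpa using h)
  · simp [hf.2]

/-- The number of ordered pairs of parallel edges of `f`, edges being counted with orientation. -/
def parallelCount (f : Fin 8 → Fin 8) : ℕ :=
  #{p : Fin 8 × Fin 8 | IsQuad p.1 (f p.1) p.2 (f p.2)}

theorem parallelCount_conj {σ : Equiv.Perm (Fin 8)} (hσ : IsAutH8 σ) (f : Fin 8 → Fin 8) :
    parallelCount (σ ∘ f ∘ σ.symm) = parallelCount f := by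
  refine (card_equiv (σ.prodCongr σ) fun p => ?_).symm
  simp [isQuad_map_iff hσ]

/-! ### Enumeration of the matchings -/

/-- The values of `f` as the octal digits of a number. -/
def code (f : Fin 8 → Fin 8) : ℕ := ∑ i, (f i).val * 8 ^ (7 - i.val)

/-- The function with given octal digits. -/
def decode (c : ℕ) (i : Fin 8) : Fin 8 := Fin.ofNat 8 (c / 8 ^ (7 - i.val))

theorem decode_code (f : Fin 8 → Fin 8) : decode (code f) = f := by
  funext i
  apply Fin.ext
  have h : ∀ j, (f j).val < 8 := fun j => (f j).isLt
  have h0 := h 0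
  have h1 := h 1
  have h2 := h 2
  have h3 := h 3
  have h4 := h 4
  have h5 := h 5
  have h6 := h 6
  have h7 := h 7
  fin_cases i <;> simp [decode, code, Fin.sum_univ_eight] <;> omega

/-- The codes of all matchings of the entries of a list of length `2 * k`, added to `c`. -/
def pairingCodes : ℕ → List (Fin 8) → ℕ → List ℕ
  | 0, _, c => [c]
  | _ + 1, [], c => [c]
  | k + 1, a :: l, c => l.flatMap fun b =>
      pairingCodes k (l.erase b) (c + (b.val * 8 ^ (7 - a.val) + a.val * 8 ^ (7 - b.val)))

/-- The codes of all matchings. -/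
def matchingCodes : List ℕ := pairingCodes 4 (List.finRange 8) 0

theorem IsMatching.mem_pairingCodes {f : Fin 8 → Fin 8} (hf : IsMatching f) (k : ℕ)
    (l : List (Fin 8)) (c : ℕ) (hl : l.Nodup) (hfl : ∀ i ∈ l, f i ∈ l)
    (hlen : l.length ≤ 2 * k) :
    c + (l.map fun i => (f i).val * 8 ^ (7 - i.val)).sum ∈ pairingCodes k l c := by
  induction k generalizing l c with
  | zero =>
    obtain rfl : l = [] := List.eq_nil_of_length_eq_zero (by omega)
    simp [pairingCodes]
  | succ k ih =>
    rcases l with _ | ⟨a, l⟩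
    · simp [pairingCodes]
    obtain ⟨ha, hl⟩ := List.nodup_cons.1 hl
    have hb : f a ∈ l := (List.mem_cons.1 (hfl a (by simp))).resolve_left (hf.1 a)
    refine List.mem_flatMap.2 ⟨f a, hb, ?_⟩
    have hsum := List.sum_map_erase (fun i => (f i).val * 8 ^ (7 - i.val)) hb
    simp only [hf.2] at hsum
    rw [List.map_cons, List.sum_cons, ← hsum, ← add_assoc (_ * _ : ℕ),
      ← add_assoc c (_ + _ : ℕ)]
    refine ih (l.erase (f a)) _ (hl.erase _) (fun i hi => ?_) ?_
    · obtain ⟨hne, hi⟩ := hl.mem_erase_iff.1 hi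
      refine hl.mem_erase_iff.2 ⟨fun h => ?_, (List.mem_cons.1 (hfl i (by simp [hi]))).resolve_left
        fun h => hne (by rw [← h, hf.2])⟩
      have hia : i = a := by rw [← hf.2 i, h, hf.2]
      exact ha (hia ▸ hi)
    · rw [List.length_erase_of_mem hb]
      simp only [List.length_cons] at hlen
      omega

theorem IsMatching.code_mem {f : Fin 8 → Fin 8} (hf : IsMatching f) :
    code f ∈ matchingCodes := by
  have h := hf.mem_pairingCodes 4 (List.finRange 8) 0 (List.nodup_finRange 8)
    (fun i _ => List.mem_finRange (f i)) (by simp)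
  rwa [zero_add, ← Fin.sum_univ_def] at h

theorem isMatching_decode : ∀ c ∈ matchingCodes, IsMatching (decode c) := by
  unfold IsMatching
  decide +kernel

theorem code_decode : ∀ c ∈ matchingCodes, code (decode c) = c := by
  decide +kernel

theorem nodup_matchingCodes : matchingCodes.Nodup := by
  have h : matchingCodes.IsChain (· < ·) := by decide +kernel
  exact (List.isChain_iff_pairwise.1 h).nodup

/-! ### The three orbits -/

/-- The matching with pairs `M1`. -/
def f1 : Fin 8 → Fin 8 := ![1, 0, 3, 2, 5, 4, 7, 6]

/-- The matching with pairs `M2`. -/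
def f2 : Fin 8 → Fin 8 := ![1, 0, 3, 2, 6, 7, 4, 5]

/-- The matching with pairs `M3`. -/
def f3 : Fin 8 → Fin 8 := ![1, 0, 4, 6, 2, 7, 3, 5]

/-- The linear map sending `1, 2, 4` to `f 0, y, z` is bijective and conjugates `f₀` to `f`. -/
def LinConj (f₀ f : Fin 8 → Fin 8) (y z : Fin 8) : Prop :=
  (∀ i, f (linMap (f 0) y z i) = linMap (f 0) y z (f₀ i)) ∧
    ∀ i, linMap (f 0) y z i = 0 → i = 0

instance (f₀ f : Fin 8 → Fin 8) (y z : Fin 8) : Decidable (LinConj f₀ f y z) :=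
  inferInstanceAs (Decidable (_ ∧ _))

/-- The number of edges of `f` parallel to `{0, f 0}`, counted with orientation. -/
def parallelZero (f : Fin 8 → Fin 8) : ℕ :=
  (List.finRange 8).countP fun i => i ^^^ f i = f 0

theorem linConj_decode : ∀ c ∈ matchingCodes,
    (parallelZero (decode c) = 8 ∧ ∃ y z, LinConj f1 (decode c) y z) ∨
    (parallelZero (decode c) = 4 ∧ ∃ z, LinConj f2 (decode c) (z ^^^ decode c z) z) ∨
    (parallelZero (decode c) = 2 ∧ ∃ y, LinConj f3 (decode c) y (decode c y)) := by
  decide +kernel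

theorem LinConj.inOrbit {f₀ f : Fin 8 → Fin 8} {y z : Fin 8} (h : LinConj f₀ f y z) :
    InOrbit (pairs f) (pairs f₀) := by
  obtain ⟨hconj, hker⟩ := h
  have hinj : Function.Injective (linMap (f 0) y z) := fun i j hij => by
    refine (xor_eq_zero i j).1 (hker _ ?_)
    rw [linMap_xor, xor_eq_zero, hij]
  let σ := Equiv.ofBijective _ (Finite.injective_iff_bijective.1 hinj)
  refine ⟨σ, isAutH8_of_linMap (x := f 0) (y := y) (z := z) fun _ => rfl, ?_⟩
  rw [markAct_pairs]
  congr 1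
  funext i
  obtain ⟨j, rfl⟩ := σ.surjective i
  simpa [σ] using hconj j

theorem IsMatching.orbit_cases {f : Fin 8 → Fin 8} (hf : IsMatching f) :
    (parallelZero f = 8 ∧ InOrbit (pairs f) (pairs f1)) ∨
    (parallelZero f = 4 ∧ InOrbit (pairs f) (pairs f2)) ∨
    (parallelZero f = 2 ∧ InOrbit (pairs f) (pairs f3)) := by
  have hcases := linConj_decode (code f) hf.code_mem
  rw [decode_code] at hcases
  rcases hcases with ⟨h, _, _, hc⟩ | ⟨h, _, hc⟩ | ⟨h, _, hc⟩
  · exact .inl ⟨h, hc.inOrbit⟩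
  · exact .inr (.inl ⟨h, hc.inOrbit⟩)
  · exact .inr (.inr ⟨h, hc.inOrbit⟩)

theorem exists_matching_of_inOrbit {M : Finset (Finset (Fin 8))} {f₀ : Fin 8 → Fin 8}
    (hf₀ : IsMatching f₀) (h : InOrbit M (pairs f₀)) :
    ∃ f, IsMatching f ∧ parallelCount f = parallelCount f₀ ∧ M = pairs f := by
  obtain ⟨σ, hσ, rfl⟩ := h
  exact ⟨_, hf₀.conj σ, parallelCount_conj hσ f₀, markAct_pairs σ f₀⟩

theorem parallelCount_eq_of_inOrbit {f f₀ : Fin 8 → Fin 8} (hf : IsMatching f)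
    (hf₀ : IsMatching f₀) (h : InOrbit (pairs f) (pairs f₀)) :
    parallelCount f = parallelCount f₀ := by
  obtain ⟨g, hg, hcount, heq⟩ := exists_matching_of_inOrbit hf₀ h
  exact pairs_injOn hf hg heq ▸ hcount

theorem isMatching_f1 : IsMatching f1 := by unfold IsMatching; decide +kernel

theorem isMatching_f2 : IsMatching f2 := by unfold IsMatching; decide +kernel

theorem isMatching_f3 : IsMatching f3 := by unfold IsMatching; decide +kernel

theorem parallelCount_f1 : parallelCount f1 = 64 := by decide +kernel

theorem parallelCount_f2 : parallelCount f2 = 32 := by decide +kernel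

theorem parallelCount_f3 : parallelCount f3 = 16 := by decide +kernel

theorem IsMatching.inOrbit_iff {f : Fin 8 → Fin 8} (hf : IsMatching f) :
    (InOrbit (pairs f) (pairs f1) ↔ parallelZero f = 8) ∧
    (InOrbit (pairs f) (pairs f2) ↔ parallelZero f = 4) ∧
    (InOrbit (pairs f) (pairs f3) ↔ parallelZero f = 2) := by
  have h1 := parallelCount_eq_of_inOrbit hf isMatching_f1
  have h2 := parallelCount_eq_of_inOrbit hf isMatching_f2
  have h3 := parallelCount_eq_of_inOrbit hf isMatching_f3
  rw [parallelCount_f1] at h1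
  rw [parallelCount_f2] at h2
  rw [parallelCount_f3] at h3
  have := hf.orbit_cases
  grind

open scoped Classical in
theorem card_orbit {f₀ : Fin 8 → Fin 8} (hf₀ : IsMatching f₀) {n : ℕ}
    (h : ∀ f, IsMatching f → (InOrbit (pairs f) (pairs f₀) ↔ parallelZero f = n)) :
    (univ.filter fun M => InOrbit M (pairs f₀)).card =
      matchingCodes.countP fun c => parallelZero (decode c) = n := by
  have heq : (univ.filter fun M => InOrbit M (pairs f₀)) =
      (matchingCodes.filter fun c => parallelZero (decode c) = n).toFinset.image
        (pairs ∘ decode) := by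
    ext M
    simp only [mem_filter, mem_univ, true_and, mem_image, List.mem_toFinset, List.mem_filter,
      decide_eq_true_eq, Function.comp_apply]
    constructor
    · intro ho
      obtain ⟨f, hf, -, rfl⟩ := exists_matching_of_inOrbit hf₀ ho
      exact ⟨code f, ⟨hf.code_mem, by rw [decode_code, (h f hf).1 ho]⟩, by rw [decode_code]⟩
    · rintro ⟨c, ⟨hc, hn⟩, rfl⟩
      exact (h _ (isMatching_decode c hc)).2 hn
  rw [heq, card_image_of_injOn, List.toFinset_card_of_nodup (nodup_matchingCodes.filter _),
    List.countP_eq_length_filter]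
  intro c hc d hd hcd
  rw [mem_coe, List.mem_toFinset, List.mem_filter] at hc hd
  rw [← code_decode c hc.1, ← code_decode d hd.1,
    pairs_injOn (isMatching_decode c hc.1) (isMatching_decode d hd.1) hcd]

theorem M1_eq : M1 = pairs f1 := by decide +kernel

theorem M2_eq : M2 = pairs f2 := by decide +kernel

theorem M3_eq : M3 = pairs f3 := by decide +kernel

end HammingMarkings

open HammingMarkings

open scoped Classical in
/-- `Aut(H₈)` has exactly three orbits on the 105 markings of the coordinate set, with
representatives `M1`, `M2`, `M3` and orbit sizes 7, 42 and 56 respectively. -/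
theorem stmt_3 :
    (∀ M : Finset (Finset (Fin 8)), IsMarking M →
      (InOrbit M M1 ∨ InOrbit M M2 ∨ InOrbit M M3)) ∧
    ¬ InOrbit M2 M1 ∧ ¬ InOrbit M3 M1 ∧ ¬ InOrbit M3 M2 ∧
    (Finset.univ.filter fun M => InOrbit M M1).card = 7 ∧
    (Finset.univ.filter fun M => InOrbit M M2).card = 42 ∧
    (Finset.univ.filter fun M => InOrbit M M3).card = 56 := by
  rw [M1_eq, M2_eq, M3_eq]
  refine ⟨fun M hM => ?_, ?_, ?_, ?_, ?_, ?_, ?_⟩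
  · obtain ⟨f, hf, rfl⟩ := exists_pairs_eq hM
    exact hf.orbit_cases.imp And.right (Or.imp And.right And.right)
  · intro h
    simpa [parallelCount_f1, parallelCount_f2] using
      parallelCount_eq_of_inOrbit isMatching_f2 isMatching_f1 h
  · intro h
    simpa [parallelCount_f1, parallelCount_f3] using
      parallelCount_eq_of_inOrbit isMatching_f3 isMatching_f1 h
  · intro h
    simpa [parallelCount_f2, parallelCount_f3] using
      parallelCount_eq_of_inOrbit isMatching_f3 isMatching_f2 h
  · rw [card_orbit isMatching_f1 fun f hf => hf.inOrbit_iff.1]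
    decide +kernel
  · rw [card_orbit isMatching_f2 fun f hf => hf.inOrbit_iff.2.1]
    decide +kernel
  · rw [card_orbit isMatching_f3 fun f hf => hf.inOrbit_iff.2.2]
    decide +kernel
end

section
/- In the automorphism group Aut(H₈) of the Hamming code H₈ (a group of order 1344), the stabilizer of the marking {{1,2},{3,4},{5,6},{7,8}} has order 192 (index 7), the stabilizer of the marking {{1,2},{3,4},{5,7},{6,8}} has order 32 (index 42), and the stabilizer of the marking {{1,2},{3,5},{4,7},{6,8}} has order 24 (index 56) and is isomorphic to the symmetric group Sym₄. -/
/-- Identifying `Fin 8` with `𝔽₂³` through binary digits, the affine map taking the values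
`a`, `b`, `c`, `d` at `0`, `1`, `2`, `4`. -/
def binaryAffineMap (a b c d : Fin 8) : Fin 8 → Fin 8 :=
  ![a, b, c, a ^^^ b ^^^ c, d, a ^^^ b ^^^ d, a ^^^ c ^^^ d, b ^^^ c ^^^ d]

/-- No two of `a`, `b`, `c`, `d` agree, and `d` is not in the affine plane through `a`, `b`, `c`. -/
abbrev AffinelyIndependent (a b c d : Fin 8) : Prop :=
  b ≠ a ∧ c ≠ a ∧ c ≠ b ∧ d ≠ a ∧ d ≠ b ∧ d ≠ c ∧ d ≠ a ^^^ b ^^^ c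

/-- `H₈` is self-dual, so membership is given by four parity checks. -/
theorem mem_H8_iff (c : Fin 8 → ZMod 2) :
    c ∈ H8 ↔ c 3 = c 0 + c 1 + c 2 ∧ c 5 = c 0 + c 1 + c 4 ∧ c 6 = c 0 + c 2 + c 4 ∧
      c 7 = c 1 + c 2 + c 4 := by
  constructor
  · intro hc
    induction hc using Submodule.span_induction with
    | mem x hx =>
      rcases hx with rfl | rfl | rfl | rfl <;> decide
    | zero => simp
    | add x y _ _ hx hy =>
      obtain ⟨h3, h5, h6, h7⟩ := hx
      obtain ⟨k3, k5, k6, k7⟩ := hy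
      simp only [Pi.add_apply, h3, h5, h6, h7, k3, k5, k6, k7]
      refine ⟨?_, ?_, ?_, ?_⟩ <;> ring
    | smul r x _ hx =>
      obtain ⟨h3, h5, h6, h7⟩ := hx
      simp only [Pi.smul_apply, smul_eq_mul, h3, h5, h6, h7]
      refine ⟨?_, ?_, ?_, ?_⟩ <;> ring
  · rintro ⟨h3, h5, h6, h7⟩
    have hsum (a b e d : ZMod 2) : ![a, b, e, a + b + e, d, a + b + d, a + e + d, b + e + d] =
        (a + d) • ![0,0,0,0,1,1,1,1] + (a + e) • ![0,0,1,1,0,0,1,1] +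
          (a + b) • ![0,1,0,1,0,1,0,1] + a • ![1,1,1,1,1,1,1,1] := by
      revert a b e d
      decide +kernel
    have hc : c = ![c 0, c 1, c 2, c 0 + c 1 + c 2, c 4, c 0 + c 1 + c 4, c 0 + c 2 + c 4,
        c 1 + c 2 + c 4] := by
      funext i
      fin_cases i <;> simp [h3, h5, h6, h7]
    rw [hc, hsum]
    refine add_mem (add_mem (add_mem ?_ ?_) ?_) ?_ <;>
      exact Submodule.smul_mem _ _ (Submodule.subset_span (by simp))

/-- The binary digits of a coordinate, which are the values of the generators of `H₈`,
determine sums in `𝔽₂³`. -/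
theorem eq_xor_iff (x a b c : Fin 8) :
    x = a ^^^ b ^^^ c ↔
      ∀ g ∈ [(![0,0,0,0,1,1,1,1] : Fin 8 → ZMod 2), ![0,0,1,1,0,0,1,1], ![0,1,0,1,0,1,0,1]],
        g x = g a + g b + g c := by
  have hadd : ∀ g ∈ [(![0,0,0,0,1,1,1,1] : Fin 8 → ZMod 2), ![0,0,1,1,0,0,1,1],
      ![0,1,0,1,0,1,0,1]], ∀ y z, g (y ^^^ z) = g y + g z := by decide +kernel
  have hinj : ∀ y z : Fin 8, y = z ↔ ∀ g ∈ [(![0,0,0,0,1,1,1,1] : Fin 8 → ZMod 2),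
      ![0,0,1,1,0,0,1,1], ![0,1,0,1,0,1,0,1]], g y = g z := by decide +kernel
  rw [hinj]
  refine forall₂_congr fun g hg => ?_
  rw [hadd g hg, hadd g hg]

theorem isAutH8_iff (σ : Equiv.Perm (Fin 8)) :
    IsAutH8 σ ↔ ⇑σ = binaryAffineMap (σ 0) (σ 1) (σ 2) (σ 4) := by
  have hspan : IsAutH8 σ ↔ ∀ c ∈ ({![0,0,0,0,1,1,1,1], ![0,0,1,1,0,0,1,1],
      ![0,1,0,1,0,1,0,1], ![1,1,1,1,1,1,1,1]} : Set (Fin 8 → ZMod 2)), c ∘ ⇑σ ∈ H8 :=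
    Submodule.span_le (p := H8.comap (LinearMap.funLeft (ZMod 2) (ZMod 2) σ))
  have hfun : ⇑σ = binaryAffineMap (σ 0) (σ 1) (σ 2) (σ 4) ↔
      σ 3 = σ 0 ^^^ σ 1 ^^^ σ 2 ∧ σ 5 = σ 0 ^^^ σ 1 ^^^ σ 4 ∧ σ 6 = σ 0 ^^^ σ 2 ^^^ σ 4 ∧
        σ 7 = σ 1 ^^^ σ 2 ^^^ σ 4 := by
    rw [funext_iff]
    simp [Fin.forall_fin_succ, binaryAffineMap]
  have hone (i : Fin 8) : (![1,1,1,1,1,1,1,1] : Fin 8 → ZMod 2) i = 1 := by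
    revert i; decide
  rw [hspan, hfun]
  simp only [eq_xor_iff, Set.mem_insert_iff, Set.mem_singleton_iff, forall_eq_or_imp, forall_eq,
    mem_H8_iff, Function.comp_apply, List.mem_cons, List.not_mem_nil, or_false, hone]
  have htwo : (1 : ZMod 2) = 1 + 1 + 1 := by decide
  tauto

theorem affinelyIndependent_iff_injective (a b c d : Fin 8) :
    AffinelyIndependent a b c d ↔ Function.Injective (binaryAffineMap a b c d) := by
  have hlist : List.ofFn (binaryAffineMap a b c d) =
      [a, b, c, a ^^^ b ^^^ c, d, a ^^^ b ^^^ d, a ^^^ c ^^^ d, b ^^^ c ^^^ d] := by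
    simp [binaryAffineMap, List.ofFn_succ]
  rw [← List.nodup_ofFn, hlist]
  clear hlist
  revert a b c d
  decide +kernel

/-- Automorphisms of `H₈` commuting with a given map correspond to affine bases. -/
theorem card_isAutH8_commuting (m : Fin 8 → Fin 8) [DecidablePred IsAutH8] :
    (Finset.univ.filter fun σ : Equiv.Perm (Fin 8) =>
      IsAutH8 σ ∧ ∀ i, σ (m i) = m (σ i)).card =
    (Finset.univ.filter fun t : Fin 8 × Fin 8 × Fin 8 × Fin 8 =>
      AffinelyIndependent t.1 t.2.1 t.2.2.1 t.2.2.2 ∧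
        ∀ i, binaryAffineMap t.1 t.2.1 t.2.2.1 t.2.2.2 (m i) =
          m (binaryAffineMap t.1 t.2.1 t.2.2.1 t.2.2.2 i)).card := by
  refine Finset.card_bij (fun σ _ => (σ 0, σ 1, σ 2, σ 4)) ?_ ?_ ?_
  · intro σ hσ
    simp only [Finset.mem_filter, Finset.mem_univ, true_and, isAutH8_iff] at hσ ⊢
    rw [affinelyIndependent_iff_injective, ← hσ.1]
    exact ⟨σ.injective, hσ.2⟩
  · intro σ hσ τ hτ h
    simp only [Finset.mem_filter, Finset.mem_univ, true_and, isAutH8_iff] at hσ hτ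
    simp only [Prod.mk.injEq] at h
    apply DFunLike.coe_injective
    rw [hσ.1, hτ.1, h.1, h.2.1, h.2.2.1, h.2.2.2]
  · rintro ⟨a, b, c, d⟩ ht
    simp only [Finset.mem_filter, Finset.mem_univ, true_and,
      affinelyIndependent_iff_injective] at ht
    refine ⟨Equiv.ofBijective _ (Finite.injective_iff_bijective.mp ht.1), ?_, rfl⟩
    simp only [Finset.mem_filter, Finset.mem_univ, true_and, isAutH8_iff]
    exact ⟨rfl, ht.2⟩

/-- A permutation preserves the partition into the orbits of an involution `m` exactly when it
commutes with `m`. -/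
theorem markAct_image_pair_eq_iff {m : Fin 8 → Fin 8} (hm : Function.Involutive m)
    (hfix : ∀ i, m i ≠ i) (σ : Equiv.Perm (Fin 8)) :
    markAct σ (Finset.univ.image fun i => {i, m i}) = Finset.univ.image (fun i => {i, m i}) ↔
      ∀ i, σ (m i) = m (σ i) := by
  have hact : markAct σ (Finset.univ.image fun i => {i, m i}) =
      Finset.univ.image fun i => {σ i, σ (m i)} := by
    simp [markAct, Finset.image_image, Function.comp_def, Finset.image_insert]
  rw [hact]
  constructor
  · intro h i
    have hi : ({σ i, σ (m i)} : Finset (Fin 8)) ∈ Finset.univ.image fun i => {i, m i} :=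
      h ▸ Finset.mem_image_of_mem _ (Finset.mem_univ i)
    obtain ⟨j, -, hj⟩ := Finset.mem_image.mp hi
    have hne : σ (m i) ≠ σ i := fun h => hfix i (σ.injective h)
    have h1 : σ i ∈ ({j, m j} : Finset (Fin 8)) := by simp [hj]
    have h2 : σ (m i) ∈ ({j, m j} : Finset (Fin 8)) := by simp [hj]
    simp only [Finset.mem_insert, Finset.mem_singleton] at h1 h2
    have := hm j
    grind
  · intro h
    ext p
    simp only [h, Finset.mem_image, Finset.mem_univ, true_and]
    exact (σ.surjective.exists (p := fun j => {j, m j} = p)).symm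

theorem markAct_M1_iff (σ : Equiv.Perm (Fin 8)) :
    markAct σ M1 = M1 ↔ ∀ i, σ (![1,0,3,2,5,4,7,6] i) = ![1,0,3,2,5,4,7,6] (σ i) := by
  have hM : M1 = Finset.univ.image fun i => {i, ![1,0,3,2,5,4,7,6] i} := by decide +kernel
  rw [hM, markAct_image_pair_eq_iff (by unfold Function.Involutive; decide) (by decide)]

theorem markAct_M2_iff (σ : Equiv.Perm (Fin 8)) :
    markAct σ M2 = M2 ↔ ∀ i, σ (![1,0,3,2,6,7,4,5] i) = ![1,0,3,2,6,7,4,5] (σ i) := by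
  have hM : M2 = Finset.univ.image fun i => {i, ![1,0,3,2,6,7,4,5] i} := by decide +kernel
  rw [hM, markAct_image_pair_eq_iff (by unfold Function.Involutive; decide) (by decide)]

theorem markAct_M3_iff (σ : Equiv.Perm (Fin 8)) :
    markAct σ M3 = M3 ↔ ∀ i, σ (![1,0,4,6,2,7,3,5] i) = ![1,0,4,6,2,7,3,5] (σ i) := by
  have hM : M3 = Finset.univ.image fun i => {i, ![1,0,4,6,2,7,3,5] i} := by decide +kernel
  rw [hM, markAct_image_pair_eq_iff (by unfold Function.Involutive; decide) (by decide)]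

/-- A labelling of the coordinates by a block of `M3` and a sign. -/
def signedBlockEquiv : Fin 4 × ℤˣ ≃ Fin 8 where
  toFun p := if p.2 = 1 then ![0,4,3,7] p.1 else ![1,2,6,5] p.1
  invFun := ![(0, 1), (0, -1), (1, -1), (2, 1), (1, 1), (3, -1), (2, -1), (3, 1)]
  left_inv := by unfold Function.LeftInverse; decide
  right_inv := by unfold Function.RightInverse Function.LeftInverse; decide

/-- `Sym₄` acts on the blocks of `M3` naturally and on the signs through the sign character. -/
def symFourHom : Equiv.Perm (Fin 4) →* Equiv.Perm (Fin 8) where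
  toFun π := signedBlockEquiv.permCongr (π.prodCongr (Equiv.mulLeft (Equiv.Perm.sign π)))
  map_one' := by ext; simp
  map_mul' π ρ := by ext; simp [Prod.map_def, mul_assoc]

theorem symFourHom_injective : Function.Injective symFourHom := by
  intro π ρ h
  ext i
  have := congrArg (fun τ => (signedBlockEquiv.symm (τ (signedBlockEquiv (i, 1)))).1) h
  simpa [symFourHom] using congrArg Fin.val this

theorem symFourHom_mem (π : Equiv.Perm (Fin 4)) :
    IsAutH8 (symFourHom π) ∧ markAct (symFourHom π) M3 = M3 := by
  rw [isAutH8_iff, markAct_M3_iff]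
  revert π
  decide +kernel

open scoped Classical in
/-- `Aut(H₈)` has order 1344; the stabilizers of the markings `M1`, `M2`, `M3` have
orders 192 (index 7), 32 (index 42) and 24 (index 56) respectively, and the stabilizer
of `M3` is isomorphic to the symmetric group `Sym₄`. -/
theorem stmt_4 :
    (Finset.univ.filter fun σ : Equiv.Perm (Fin 8) => IsAutH8 σ).card = 1344 ∧
    (Finset.univ.filter fun σ : Equiv.Perm (Fin 8) =>
      IsAutH8 σ ∧ markAct σ M1 = M1).card = 192 ∧
    (Finset.univ.filter fun σ : Equiv.Perm (Fin 8) =>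
      IsAutH8 σ ∧ markAct σ M2 = M2).card = 32 ∧
    (Finset.univ.filter fun σ : Equiv.Perm (Fin 8) =>
      IsAutH8 σ ∧ markAct σ M3 = M3).card = 24 ∧
    ∃ φ : Equiv.Perm (Fin 4) →* Equiv.Perm (Fin 8),
      Function.Injective ⇑φ ∧
        Set.range ⇑φ = {σ : Equiv.Perm (Fin 8) | IsAutH8 σ ∧ markAct σ M3 = M3} := by
  have h3 : (Finset.univ.filter fun σ : Equiv.Perm (Fin 8) =>
      IsAutH8 σ ∧ markAct σ M3 = M3).card = 24 := by
    simp only [markAct_M3_iff]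
    convert card_isAutH8_commuting _ using 1
    decide +kernel
  refine ⟨?_, ?_, ?_, h3, symFourHom, symFourHom_injective, ?_⟩
  · have h := card_isAutH8_commuting id
    simp only [id, implies_true, and_true] at h
    convert h using 1
    decide +kernel
  · simp only [markAct_M1_iff]
    convert card_isAutH8_commuting _ using 1
    decide +kernel
  · simp only [markAct_M2_iff]
    convert card_isAutH8_commuting _ using 1
    decide +kernel
  · have hsub : Finset.univ.image symFourHom ⊆ Finset.univ.filter fun σ : Equiv.Perm (Fin 8) =>
        IsAutH8 σ ∧ markAct σ M3 = M3 := by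
      intro σ hσ
      obtain ⟨π, -, rfl⟩ := Finset.mem_image.mp hσ
      simpa using symFourHom_mem π
    have heq := Finset.eq_of_subset_of_card_le hsub (by
      rw [h3, Finset.card_image_of_injective _ symFourHom_injective, Finset.card_univ,
        Fintype.card_perm, Fintype.card_fin]
      decide)
    simpa using congrArg (fun s : Finset (Equiv.Perm (Fin 8)) => (s : Set (Equiv.Perm (Fin 8)))) heq
end

section
/- Let d ≥ 1 and let V = (ZMod 2)^d. (i) The set J₀ = {v ↦ ℓ(v) : ℓ an 𝔽₂-linear functional on V}, regarded as a subspace of the space of functions V → ZMod 2 (a code of length 2^d), has dimension d and every nonzero codeword of J₀ has Hamming weight 2^{d−1}. (ii) Conversely, any 𝔽₂-linear subspace J of (ZMod 2)^{2^d} of dimension d in which every nonzero codeword has Hamming weight 2^{d−1} is equivalent to J₀ by a permutation of coordinates: there is a bijection σ from Fin(2^d) to V such that {c ∘ σ⁻¹ : c ∈ J} = J₀. -/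
/-- The code of all `𝔽₂`-linear functionals on `V = (ZMod 2)^d`, viewed as a subspace of
the space of all functions `V → ZMod 2` (a code of length `2^d`). -/
def J0 (d : ℕ) : Submodule (ZMod 2) ((Fin d → ZMod 2) → ZMod 2) where
  carrier := {f | ∃ ℓ : (Fin d → ZMod 2) →ₗ[ZMod 2] ZMod 2, ⇑ℓ = f}
  zero_mem' := ⟨0, rfl⟩
  add_mem' := by
    rintro f g ⟨ℓ, rfl⟩ ⟨m, rfl⟩
    exact ⟨ℓ + m, rfl⟩
  smul_mem' := by
    rintro c f ⟨ℓ, rfl⟩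
    exact ⟨c • ℓ, rfl⟩

open Finset in
/-- A nonzero linear functional on a finite `𝔽₂`-space is nonzero on exactly half the space. -/
theorem two_mul_card_filter_functional_ne_zero {W : Type*} [AddCommGroup W] [Module (ZMod 2) W]
    [Fintype W] (ℓ : W →ₗ[ZMod 2] ZMod 2) (hℓ : ℓ ≠ 0) :
    2 * #{w | ℓ w ≠ 0} = Fintype.card W := by
  classical
  obtain ⟨u, hu⟩ : ∃ u, ℓ u ≠ 0 := by
    by_contra! h
    exact hℓ (LinearMap.ext h)
  have key : ∀ a b : ZMod 2, b ≠ 0 → (a + b = 0 ↔ a ≠ 0) := by decide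
  have hcard : #{w | ℓ w ≠ 0} = #{w | ¬ ℓ w ≠ 0} := by
    refine card_equiv (Equiv.addRight u) fun w => ?_
    simp [key _ _ hu]
  have hsum := card_filter_add_card_filter_not (s := (univ : Finset W)) (fun w => ℓ w ≠ 0)
  rw [card_univ] at hsum
  omega

theorem finrank_J0 (d : ℕ) : Module.finrank (ZMod 2) (J0 d) = d := by
  have hrange : J0 d =
      LinearMap.range (LinearMap.ltoFun (ZMod 2) (Fin d → ZMod 2) (ZMod 2) (ZMod 2)) := by
    ext f
    rfl
  rw [hrange, LinearMap.finrank_range_of_inj DFunLike.coe_injective]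
  simp

open Finset in
/-- In a binary code of length `2 ^ d` and dimension `d` with all nonzero weights `2 ^ (d - 1)`,
the codewords separate the coordinates. -/
theorem eq_of_forall_codeword_eq {d : ℕ} (hd : 1 ≤ d)
    (J : Submodule (ZMod 2) (Fin (2 ^ d) → ZMod 2)) (hJ : Module.finrank (ZMod 2) J = d)
    (hw : ∀ c ∈ J, c ≠ 0 → #{i | c i ≠ 0} = 2 ^ (d - 1))
    {i j : Fin (2 ^ d)} (hij : ∀ c ∈ J, c i = c j) : i = j := by
  classical
  have hpow : 2 ^ d = 2 * 2 ^ (d - 1) := by rw [← pow_succ', Nat.sub_add_cancel hd]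
  have hcardJ : Fintype.card J = 2 ^ d := by
    rw [Module.card_eq_pow_finrank (K := ZMod 2), hJ, ZMod.card]
  -- Each nonzero codeword differs from its value at `j` in half of the coordinates.
  have hrow : ∀ c : J, #{k | c.1 k ≠ c.1 j} = if c = 0 then 0 else 2 ^ (d - 1) := by
    intro c
    split_ifs with hc
    · simp [hc]
    · have hwc := hw c.1 c.2 (by simpa using hc)
      by_cases hcj : c.1 j = 0
      · simpa [hcj] using hwc
      · have hsum := card_filter_add_card_filter_not (s := (univ : Finset (Fin (2 ^ d))))
          (fun k => c.1 k ≠ 0)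
        have key : ∀ a b : ZMod 2, b ≠ 0 → (a ≠ b ↔ ¬ a ≠ 0) := by decide
        rw [card_univ, Fintype.card_fin] at hsum
        simp only [key _ _ hcj]
        omega
  -- Two coordinates not identified by `J` are told apart by half of the codewords.
  have hcol : ∀ k, #{c : J | c.1 k ≠ c.1 j} =
      if ∀ c ∈ J, c k = c j then 0 else 2 ^ (d - 1) := by
    intro k
    split_ifs with hk
    · simpa [filter_eq_empty_iff] using hk
    · let π (m : Fin (2 ^ d)) : (Fin (2 ^ d) → ZMod 2) →ₗ[ZMod 2] ZMod 2 := LinearMap.proj m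
      let ℓ : J →ₗ[ZMod 2] ZMod 2 := (π k - π j) ∘ₗ J.subtype
      have hℓ : ℓ ≠ 0 := fun h => hk fun c hc => sub_eq_zero.mp (LinearMap.congr_fun h ⟨c, hc⟩)
      have h2 := two_mul_card_filter_functional_ne_zero ℓ hℓ
      have hfilter : ∀ c : J, ℓ c ≠ 0 ↔ c.1 k ≠ c.1 j := fun c => sub_ne_zero
      simp only [hfilter] at h2
      omega
  have hcount := sum_card_bipartiteAbove_eq_sum_card_bipartiteBelow
    (s := (univ : Finset J)) (t := (univ : Finset (Fin (2 ^ d)))) (fun c k => c.1 k ≠ c.1 j)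
  simp only [bipartiteAbove, bipartiteBelow, hrow, hcol, sum_ite, sum_const_zero, zero_add,
    sum_const, smul_eq_mul] at hcount
  have heq := Nat.eq_of_mul_eq_mul_right (by positivity) hcount
  have hJsum := card_filter_add_card_filter_not (s := (univ : Finset J)) (fun c => c = 0)
  have hksum := card_filter_add_card_filter_not (s := (univ : Finset (Fin (2 ^ d))))
    (fun k => ∀ c ∈ J, c k = c j)
  have hzero : #{c : J | c = 0} = 1 := by simp [filter_eq']
  rw [card_univ, hcardJ] at hJsum
  rw [card_univ, Fintype.card_fin] at hksum
  have hone : #{k | ∀ c ∈ J, c k = c j} = 1 := by omega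
  exact card_le_one.mp hone.le i (by simpa using hij) j (by simp)

/-- (i) The code `J0 d` has dimension `d` and all its nonzero codewords have Hamming
weight `2^{d-1}`.  (ii) Conversely, every binary code of length `2^d` and dimension `d`
in which all nonzero codewords have weight `2^{d-1}` is equivalent to `J0 d` by a
permutation of coordinates. -/
theorem stmt_9 (d : ℕ) (hd : 1 ≤ d) :
    (Module.finrank (ZMod 2) (J0 d) = d ∧
      ∀ f ∈ J0 d, f ≠ 0 →
        (Finset.univ.filter fun v : Fin d → ZMod 2 => f v ≠ 0).card = 2 ^ (d - 1)) ∧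
    ∀ J : Submodule (ZMod 2) (Fin (2 ^ d) → ZMod 2),
      Module.finrank (ZMod 2) J = d →
      (∀ c ∈ J, c ≠ 0 →
        (Finset.univ.filter fun i => c i ≠ 0).card = 2 ^ (d - 1)) →
      ∃ σ : Fin (2 ^ d) ≃ (Fin d → ZMod 2),
        (fun c : Fin (2 ^ d) → ZMod 2 => c ∘ ⇑σ.symm) '' (J : Set (Fin (2 ^ d) → ZMod 2)) =
          (J0 d : Set ((Fin d → ZMod 2) → ZMod 2)) := by
  refine ⟨⟨finrank_J0 d, ?_⟩, fun J hJ hw => ?_⟩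
  · rintro _ ⟨ℓ, rfl⟩ hf
    have h2 := two_mul_card_filter_functional_ne_zero ℓ fun h => hf (by rw [h]; rfl)
    have hpow : 2 ^ d = 2 * 2 ^ (d - 1) := by rw [← pow_succ', Nat.sub_add_cancel hd]
    simp only [Fintype.card_fun, ZMod.card, Fintype.card_fin] at h2
    omega
  · let b := Module.finBasisOfFinrankEq (ZMod 2) J hJ
    have hrepr : ∀ c : J, ∀ i, c.1 i = ∑ k, b.repr c k * (b k).1 i := by
      intro c i
      have h := congrArg (fun x : J => x.1 i) (b.sum_repr c)
      simp only [Submodule.coe_sum, Submodule.coe_smul, Finset.sum_apply, Pi.smul_apply,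
        smul_eq_mul] at h
      exact h.symm
    let φ : Fin (2 ^ d) → Fin d → ZMod 2 := fun i k => (b k).1 i
    have hφ : Function.Injective φ := fun i j hij =>
      eq_of_forall_codeword_eq hd J hJ hw fun c hc => by
        refine (hrepr ⟨c, hc⟩ i).trans (Eq.trans ?_ (hrepr ⟨c, hc⟩ j).symm)
        exact Finset.sum_congr rfl fun k _ => congrArg (_ * ·) (congrFun hij k)
    let σ := Equiv.ofBijective φ
      ((Fintype.bijective_iff_injective_and_card φ).mpr ⟨hφ, by simp⟩)
    have hσ : ∀ v k, (b k).1 (σ.symm v) = v k := fun v k =>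
      congrFun (σ.apply_symm_apply v) k
    refine ⟨σ, Set.Subset.antisymm ?_ ?_⟩
    · rintro _ ⟨c, hc, rfl⟩
      refine ⟨∑ k, b.repr ⟨c, hc⟩ k • LinearMap.proj k, funext fun v => ?_⟩
      have h := hrepr ⟨c, hc⟩ (σ.symm v)
      simp only [hσ] at h
      simpa using h.symm
    · rintro _ ⟨ℓ, rfl⟩
      refine ⟨(∑ k, ℓ (fun j => if k = j then 1 else 0) • b k : J), SetLike.coe_mem _, funext fun v => ?_⟩
      rw [ℓ.pi_apply_eq_sum_univ v]
      simp [hσ, mul_comm]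
end

section
/- Let d ≥ 1 and let J be an 𝔽₂-linear subspace of (ZMod 2)^Ω, where Ω is an index set of cardinality 2^d, such that J has dimension d and every nonzero codeword of J has Hamming weight 2^{d−1}. If x₁, …, x_m are linearly independent elements of J, then the set {ω ∈ Ω : x₁(ω) = x₂(ω) = ⋯ = x_m(ω) = 1} has exactly 2^{d−m} elements. -/
/-- The nontrivial additive character of `ZMod 2` with values in `ℤ`. -/
def zmodTwoSignChar : AddChar (ZMod 2) ℤ where
  toFun a := if a = 0 then 1 else -1
  map_zero_eq_one' := by decide
  map_add_eq_mul' := by decide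

theorem AddChar.map_finset_sum_eq_prod {A M ι : Type*} [AddCommMonoid A] [CommMonoid M]
    (ψ : AddChar A M) (s : Finset ι) (f : ι → A) : ψ (∑ i ∈ s, f i) = ∏ i ∈ s, ψ (f i) := by
  classical
  induction s using Finset.induction_on with
  | empty => simp
  | insert i s hi ih =>
    rw [Finset.sum_insert hi, Finset.prod_insert hi, ψ.map_add_eq_mul, ih]

theorem one_add_neg_zmodTwoSignChar (a : ZMod 2) :
    1 + -zmodTwoSignChar a = if a = 1 then 2 else 0 := by
  revert a; decide

/-- The character sum of a word is its length minus twice its weight. -/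
theorem sum_zmodTwoSignChar {Ω : Type*} [Fintype Ω] (c : Ω → ZMod 2) :
    ∑ ω, zmodTwoSignChar (c ω) =
      (Fintype.card Ω : ℤ) - 2 * (Finset.univ.filter fun ω => c ω ≠ 0).card := by
  have h : ∀ a : ZMod 2, zmodTwoSignChar a = 1 - 2 * if a ≠ 0 then 1 else 0 := by decide
  simp_rw [h, Finset.sum_sub_distrib, ← Finset.mul_sum, Finset.sum_boole]
  simp

theorem LinearIndependent.sum_finset_ne_zero {ι R M : Type*} [Ring R] [Nontrivial R]
    [AddCommGroup M] [Module R M] {x : ι → M} (hx : LinearIndependent R x) {s : Finset ι}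
    (hs : s.Nonempty) : ∑ i ∈ s, x i ≠ 0 := by
  intro h
  obtain ⟨i, hi⟩ := hs
  exact one_ne_zero (linearIndependent_iff'.1 hx s (fun _ => (1 : R)) (by simpa using h) i hi)

/-- If every nonempty subfamily of `x` sums to a word whose weight is half its length, then the
common support of `x` has density `2 ^ (-card ι)`. -/
theorem two_pow_mul_card_common_support {Ω ι : Type*} [Fintype Ω] [Fintype ι]
    (x : ι → Ω → ZMod 2)
    (hx : ∀ s : Finset ι, s.Nonempty →
      2 * (Finset.univ.filter fun ω => (∑ i ∈ s, x i) ω ≠ 0).card = Fintype.card Ω) :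
    2 ^ Fintype.card ι * (Finset.univ.filter fun ω => ∀ i, x i ω = 1).card =
      Fintype.card Ω := by
  classical
  have hprod : ∀ ω, ∏ i, (1 + -zmodTwoSignChar (x i ω)) =
      2 ^ Fintype.card ι * if ∀ i, x i ω = 1 then (1 : ℤ) else 0 := by
    intro ω
    simp_rw [one_add_neg_zmodTwoSignChar]
    split_ifs with h
    · simp [h]
    · obtain ⟨i, hi⟩ := not_forall.1 h
      rw [mul_zero]
      exact Finset.prod_eq_zero (Finset.mem_univ i) (if_neg hi)
  have hzero : ∀ s : Finset ι, s ≠ ∅ →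
      ∑ ω, ∏ i ∈ s, -zmodTwoSignChar (x i ω) = 0 := by
    intro s hs
    simp_rw [Finset.prod_neg, ← AddChar.map_finset_sum_eq_prod, ← Finset.mul_sum, ← Finset.sum_apply]
    rw [sum_zmodTwoSignChar, ← hx s (Finset.nonempty_iff_ne_empty.2 hs)]
    simp
  have key : ∑ ω, ∏ i, (1 + -zmodTwoSignChar (x i ω)) = (Fintype.card Ω : ℤ) := by
    simp_rw [Finset.prod_one_add]
    rw [Finset.sum_comm, Finset.sum_eq_single ∅ (fun s _ hs => hzero s hs) (by simp)]
    simp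
  simp_rw [hprod, ← Finset.mul_sum, Finset.sum_boole] at key
  exact_mod_cast key

/-- If `J` is a binary code of length `2^d` and dimension `d` all of whose nonzero
codewords have Hamming weight `2^{d-1}`, then any `m` linearly independent codewords
have common support (all coordinates equal to `1`) of size exactly `2^{d-m}`. -/
theorem stmt_10 (d : ℕ) (hd : 1 ≤ d) (Ω : Type) [Fintype Ω] (hΩ : Fintype.card Ω = 2 ^ d)
    (J : Submodule (ZMod 2) (Ω → ZMod 2))
    (hrank : Module.finrank (ZMod 2) J = d)
    (hwt : ∀ c ∈ J, c ≠ 0 → (Finset.univ.filter fun ω => c ω ≠ 0).card = 2 ^ (d - 1))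
    (m : ℕ) (x : Fin m → (Ω → ZMod 2)) (hxJ : ∀ i, x i ∈ J)
    (hli : LinearIndependent (ZMod 2) x) :
    (Finset.univ.filter fun ω => ∀ i, x i ω = 1).card = 2 ^ (d - m) := by
  have hmd : m ≤ d := by
    have hliJ : LinearIndependent (ZMod 2) fun i => (⟨x i, hxJ i⟩ : J) :=
      LinearIndependent.of_comp J.subtype hli
    simpa [hrank] using hliJ.fintype_card_le_finrank
  have h := two_pow_mul_card_common_support x fun s hs => by
    rw [hwt _ (J.sum_mem fun i _ => hxJ i) (hli.sum_finset_ne_zero hs), hΩ, ← pow_succ',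
      Nat.sub_add_cancel hd]
  rw [Fintype.card_fin, hΩ, ← pow_mul_pow_sub 2 hmd] at h
  convert Nat.eq_of_mul_eq_mul_left (Nat.two_pow_pos m) h
end

section
/- Let d ≥ 1 and let J be an 𝔽₂-linear subspace of (ZMod 2)^Ω, where Ω has cardinality 2^d, such that J has dimension d and every nonzero codeword of J has Hamming weight 2^{d−1}. Then for every basis x₁, …, x_d of J there is a bijection σ : Ω → (ZMod 2)^d such that for all i and all ω ∈ Ω, x_i(ω) equals the i-th coordinate of σ(ω). In other words, any basis of J is carried by a coordinate permutation to the standard set of binary digit vectors of length 2^d. -/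
/-- The nontrivial additive character of `ZMod 2`, with integer values. -/
def binarySign (z : ZMod 2) : ℤ := if z = 0 then 1 else -1

theorem binarySign_add (a b : ZMod 2) : binarySign (a + b) = binarySign a * binarySign b := by
  revert a b
  decide

theorem sum_binarySign_dotProduct_eq_zero {ι : Type*} [Fintype ι] [DecidableEq ι]
    {w : ι → ZMod 2} (hw : w ≠ 0) : ∑ a : ι → ZMod 2, binarySign (a ⬝ᵥ w) = 0 := by
  obtain ⟨i, hi⟩ := Function.ne_iff.mp hw
  have hneg : binarySign (w i) = -1 := if_neg hi
  have htranslate := Equiv.sum_comp (Equiv.addRight (Pi.single i 1 : ι → ZMod 2))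
    fun a : ι → ZMod 2 => binarySign (a ⬝ᵥ w)
  simp only [Equiv.coe_addRight, add_dotProduct, single_dotProduct, one_mul, binarySign_add,
    hneg, ← Finset.sum_mul] at htranslate
  linarith

theorem sum_binarySign_eq {Ω : Type*} [Fintype Ω] (c : Ω → ZMod 2) :
    ∑ ω, binarySign (c ω) =
      Fintype.card Ω - 2 * ((Finset.univ.filter fun ω => c ω ≠ 0).card : ℤ) := by
  have hsign (ω : Ω) : binarySign (c ω) = 1 - 2 * (if c ω ≠ 0 then 1 else 0) := by
    by_cases h : c ω = 0 <;> simp [binarySign, h]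
  simp only [hsign, Finset.sum_sub_distrib, ← Finset.mul_sum, Finset.sum_boole]
  simp

/-- Any basis of a binary code of length `2^d`, dimension `d`, all of whose nonzero
codewords have Hamming weight `2^{d-1}`, is carried by a permutation (relabelling) of
the coordinates to the standard digit functions on `(ZMod 2)^d`. -/
theorem stmt_11 (d : ℕ) (hd : 1 ≤ d) (Ω : Type) [Fintype Ω] (hΩ : Fintype.card Ω = 2 ^ d)
    (J : Submodule (ZMod 2) (Ω → ZMod 2))
    (hrank : Module.finrank (ZMod 2) J = d)
    (hwt : ∀ c ∈ J, c ≠ 0 → (Finset.univ.filter fun ω => c ω ≠ 0).card = 2 ^ (d - 1))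
    (x : Fin d → (Ω → ZMod 2)) (hxJ : ∀ i, x i ∈ J)
    (hli : LinearIndependent (ZMod 2) x)
    (hspan : Submodule.span (ZMod 2) (Set.range x) = J) :
    ∃ σ : Ω ≃ (Fin d → ZMod 2), ∀ (i : Fin d) (ω : Ω), x i ω = σ ω i := by
  classical
  let φ : Ω → Fin d → ZMod 2 := fun ω i => x i ω
  have hcomb (a : Fin d → ZMod 2) : (fun ω => a ⬝ᵥ φ ω) = ∑ i, a i • x i := by
    ext ω
    simp [φ, dotProduct]
  have hbalanced (a : Fin d → ZMod 2) (ha : a ≠ 0) : ∑ ω, binarySign (a ⬝ᵥ φ ω) = 0 := by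
    have hmem : (fun ω => a ⬝ᵥ φ ω) ∈ J := by
      rw [hcomb]
      exact J.sum_mem fun i _ => J.smul_mem _ (hxJ i)
    have hne : (fun ω => a ⬝ᵥ φ ω) ≠ 0 := by
      rw [hcomb]
      exact fun h => ha (funext (Fintype.linearIndependent_iff.mp hli a h))
    rw [sum_binarySign_eq fun ω => a ⬝ᵥ φ ω, hwt _ hmem hne, hΩ]
    obtain ⟨k, rfl⟩ := Nat.exists_eq_add_of_le' hd
    simp [pow_succ']
  have hsurj : Function.Surjective φ := by
    intro v
    by_contra! hv
    have hzero : ∑ a : Fin d → ZMod 2, ∑ ω, binarySign (a ⬝ᵥ (φ ω - v)) = 0 := by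
      rw [Finset.sum_comm]
      exact Finset.sum_eq_zero fun ω _ =>
        sum_binarySign_dotProduct_eq_zero (sub_ne_zero.mpr (hv ω))
    simp only [sub_eq_add_neg, dotProduct_add, binarySign_add, ← Finset.sum_mul] at hzero
    rw [Finset.sum_eq_single 0 (fun a _ ha => by rw [hbalanced a ha, zero_mul]) (by simp)] at hzero
    simp [binarySign, hΩ] at hzero
  have hbij : Function.Bijective φ :=
    (Fintype.bijective_iff_surjective_and_card φ).mpr ⟨hsurj, by simp [hΩ]⟩
  exact ⟨Equiv.ofBijective φ hbij, fun _ _ => rfl⟩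
end

section
/- Let d ≥ 1, let V = (ZMod 2)^d, let J be the code of all 𝔽₂-linear maps V → ZMod 2, and let K = J + 𝔽₂·z, where z is the all-ones function on V (so K is the code of all affine maps V → ZMod 2). Then a permutation σ of V satisfies c ∘ σ ∈ K for every c ∈ K if and only if σ is an affine transformation of V, i.e. σ(v) = A(v) + b for some 𝔽₂-linear automorphism A of V and some b ∈ V. Hence the automorphism group of K is isomorphic to AGL(d, 𝔽₂), and the subgroup of automorphisms acting trivially modulo 𝔽₂·z is the translation subgroup. -/
/-- The code of all affine maps `V → ZMod 2` on `V = (ZMod 2)^d`, i.e. `K = J + 𝔽₂·z`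
where `J` is the code of linear functionals and `z` the all-ones vector. -/
def affCode (d : ℕ) : Set ((Fin d → ZMod 2) → ZMod 2) :=
  {f | ∃ (ℓ : (Fin d → ZMod 2) →ₗ[ZMod 2] ZMod 2) (b : ZMod 2), ∀ v, f v = ℓ v + b}

/-- Every coordinate function is a word of the affine code. -/
lemma coord_mem_affCode (d : ℕ) (i : Fin d) :
    (fun v : Fin d → ZMod 2 => v i) ∈ affCode d :=
  ⟨LinearMap.proj i, 0, fun v => by simp⟩

/-- A permutation of `V = (ZMod 2)^d` preserves the code `K` of affine maps iff it is an
affine transformation `v ↦ A v + b`; hence `Aut(K) ≅ AGL(d,𝔽₂)`.  Moreover an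
automorphism of `K` acts trivially modulo `𝔽₂·z` iff it is a translation. -/
theorem stmt_13 (d : ℕ) (hd : 1 ≤ d) :
    (∀ σ : Equiv.Perm (Fin d → ZMod 2),
      (∀ c ∈ affCode d, c ∘ ⇑σ ∈ affCode d) ↔
        ∃ (A : (Fin d → ZMod 2) ≃ₗ[ZMod 2] (Fin d → ZMod 2)) (b : Fin d → ZMod 2),
          ∀ v, σ v = A v + b) ∧
    ∀ σ : Equiv.Perm (Fin d → ZMod 2), (∀ c ∈ affCode d, c ∘ ⇑σ ∈ affCode d) →
      ((∀ c ∈ affCode d, ∃ ε : ZMod 2, ∀ v, c (σ v) = c v + ε) ↔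
        ∃ b : Fin d → ZMod 2, ∀ v, σ v = v + b) := by
  refine ⟨fun σ => ⟨fun h => ?_, ?_⟩, fun σ _ => ⟨fun h => ?_, ?_⟩⟩
  · choose ℓ b hℓ using fun i => h _ (coord_mem_affCode d i)
    have hσ : ∀ v, σ v = LinearMap.pi ℓ v + b := fun v => funext fun i => hℓ i v
    have hbij : Function.Bijective (LinearMap.pi ℓ) := by
      have heq : ⇑(LinearMap.pi ℓ) = ⇑(σ.trans (Equiv.subRight b)) := by
        funext v
        simp [hσ]
      rw [heq]
      exact Equiv.bijective _
    exact ⟨LinearEquiv.ofBijective _ hbij, b, hσ⟩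
  · rintro ⟨A, b, hσ⟩ c ⟨ℓ, e, hc⟩
    exact ⟨ℓ ∘ₗ A.toLinearMap, ℓ b + e, fun v => by simp [hc, hσ, add_assoc]⟩
  · choose ε hε using fun i => h _ (coord_mem_affCode d i)
    exact ⟨ε, fun v => funext fun i => hε i v⟩
  · rintro ⟨b, hσ⟩ c ⟨ℓ, e, hc⟩
    exact ⟨ℓ b, fun v => by simp [hc, hσ, add_right_comm]⟩
end

section
/- Let d ≥ 1, let V = (ZMod 2)^d, let Ω = Fin 3 × V, and let D ⊆ (ZMod 2)^Ω be the 𝔽₂-span of the three block indicator functions (i,v) ↦ [i = i₀] for i₀ ∈ Fin 3 together with the d functions (i,v) ↦ v_j for j = 1, …, d. Let F be the group of permutations σ of Ω with c ∘ σ ∈ D for all c ∈ D. Then every σ ∈ F permutes the three blocks {i} × V (i ∈ Fin 3), i.e. there is π_σ ∈ Perm(Fin 3) with σ({i} × V) = {π_σ(i)} × V for all i, and the resulting homomorphism F → Perm(Fin 3), σ ↦ π_σ, is surjective. -/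
/-- The code `D` of length `3·2^d` on the index set `Ω = Fin 3 × (ZMod 2)^d`: the span of
the three block indicator functions together with the `d` binary digit functions
(repeated identically on each of the three blocks). -/
def codeD (d : ℕ) : Submodule (ZMod 2) ((Fin 3 × (Fin d → ZMod 2)) → ZMod 2) :=
  Submodule.span (ZMod 2)
    ({f | ∃ i₀ : Fin 3, f = fun p => if p.1 = i₀ then 1 else 0} ∪
      {f | ∃ j : Fin d, f = fun p => p.2 j})

/-- The codewords are the functions `(i, v) ↦ a i + w ⬝ᵥ v`. -/
theorem mem_codeD_iff {d : ℕ} {c : Fin 3 × (Fin d → ZMod 2) → ZMod 2} :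
    c ∈ codeD d ↔ ∃ (a : Fin 3 → ZMod 2) (w : Fin d → ZMod 2),
      ∀ p, c p = a p.1 + w ⬝ᵥ p.2 := by
  constructor
  · intro hc
    induction hc using Submodule.span_induction with
    | mem f hf =>
      rcases hf with ⟨i, rfl⟩ | ⟨j, rfl⟩
      · exact ⟨fun k => if k = i then 1 else 0, 0, fun p => by simp⟩
      · exact ⟨0, Pi.single j 1, fun p => by simp⟩
    | zero => exact ⟨0, 0, fun p => by simp⟩
    | add f g _ _ hf hg =>
      obtain ⟨a, w, hf⟩ := hf
      obtain ⟨b, x, hg⟩ := hg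
      refine ⟨a + b, w + x, fun p => ?_⟩
      simp only [Pi.add_apply, hf, hg, add_dotProduct]
      ring
    | smul r f _ hf =>
      obtain ⟨a, w, hf⟩ := hf
      refine ⟨r • a, r • w, fun p => ?_⟩
      simp only [Pi.smul_apply, hf, smul_dotProduct, smul_add]
  · rintro ⟨a, w, h⟩
    have hc : c = ∑ i, a i • (fun p : Fin 3 × (Fin d → ZMod 2) => if p.1 = i then 1 else 0) +
        ∑ j, w j • (fun p : Fin 3 × (Fin d → ZMod 2) => p.2 j) := by
      funext p
      simp [h, Finset.sum_apply, dotProduct]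
    rw [hc]
    exact add_mem
      (sum_mem fun i _ => Submodule.smul_mem _ _ (Submodule.subset_span (Or.inl ⟨i, rfl⟩)))
      (sum_mem fun j _ => Submodule.smul_mem _ _ (Submodule.subset_span (Or.inr ⟨j, rfl⟩)))

/-- No permutation exchanges a block with its complement. -/
theorem not_perm_swaps_block {V : Type*} [Fintype V] [Nonempty V] (i : Fin 3)
    (τ : Equiv.Perm (Fin 3 × V)) : ¬ ∀ p, (τ p).1 = i ↔ p.1 ≠ i := by
  classical
  intro h
  have hcard : ((({i}ᶜ : Finset (Fin 3)) ×ˢ (Finset.univ : Finset V))).card =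
      ((({i} : Finset (Fin 3)) ×ˢ (Finset.univ : Finset V))).card :=
    Finset.card_equiv τ fun p => by
      simp only [Finset.mem_product, Finset.mem_compl, Finset.mem_singleton, Finset.mem_univ,
        and_true, h p, ne_eq]
  have hpos : 0 < Fintype.card V := Fintype.card_pos
  simp only [Finset.card_product, Finset.card_compl, Finset.card_singleton, Fintype.card_fin,
    Finset.card_univ] at hcard
  omega

/-- An automorphism pulls each block indicator back to a function of the block index. -/
theorem fst_perm_eq_of_fst_eq {d : ℕ} {σ : Equiv.Perm (Fin 3 × (Fin d → ZMod 2))}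
    (hσ : ∀ c ∈ codeD d, c ∘ ⇑σ ∈ codeD d) {p q : Fin 3 × (Fin d → ZMod 2)}
    (hpq : p.1 = q.1) : (σ p).1 = (σ q).1 := by
  obtain ⟨a, w, h⟩ := mem_codeD_iff.1
    (hσ _ (Submodule.subset_span (Or.inl ⟨(σ q).1, rfl⟩)))
  simp only [Function.comp_apply] at h
  have hw : w = 0 := by
    by_contra hw
    obtain ⟨j, hj⟩ := Function.ne_iff.1 hw
    replace hj : w j = 1 := Fin.eq_one_of_ne_zero (w j) hj
    let T : Equiv.Perm (Fin 3 × (Fin d → ZMod 2)) :=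
      (Equiv.refl _).prodCongr (Equiv.addRight (Pi.single j 1))
    refine not_perm_swaps_block (σ q).1 (σ.symm.trans (T.trans σ)) fun p => ?_
    have h₁ := h (σ.symm p)
    have h₂ := h (T (σ.symm p))
    have hT : T (σ.symm p) = ((σ.symm p).1, (σ.symm p).2 + Pi.single j 1) := rfl
    rw [hT] at h₂
    simp only [dotProduct_add, dotProduct_single, hj, mul_one, ← add_assoc] at h₂
    rw [← h₁, Equiv.apply_symm_apply] at h₂
    simp only [Equiv.trans_apply, hT]
    by_cases hp : p.1 = (σ q).1
    · rw [if_pos hp] at h₂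
      simp only [hp, ne_eq, not_true, iff_false]
      intro hT'
      simp [hT'] at h₂
    · simp only [hp, ne_eq, not_false_eq_true, iff_true]
      by_contra hT'
      simp [hp, hT'] at h₂
  subst hw
  have hp := h p
  rw [hpq, zero_dotProduct, ← zero_dotProduct q.2, ← h q, if_pos rfl] at hp
  by_contra hne
  simp [hne] at hp

/-- Every automorphism of the code `D` permutes the three coordinate blocks `{i} × V`,
and the resulting homomorphism to `Perm (Fin 3)` is surjective. -/
theorem stmt_14 (d : ℕ) (hd : 1 ≤ d) :
    (∀ σ : Equiv.Perm (Fin 3 × (Fin d → ZMod 2)),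
      (∀ c ∈ codeD d, c ∘ ⇑σ ∈ codeD d) →
        ∃ π : Equiv.Perm (Fin 3), ∀ p : Fin 3 × (Fin d → ZMod 2), (σ p).1 = π p.1) ∧
    ∀ π : Equiv.Perm (Fin 3), ∃ σ : Equiv.Perm (Fin 3 × (Fin d → ZMod 2)),
      (∀ c ∈ codeD d, c ∘ ⇑σ ∈ codeD d) ∧
        ∀ p : Fin 3 × (Fin d → ZMod 2), (σ p).1 = π p.1 := by
  refine ⟨fun σ hσ => ?_, fun π => ⟨π.prodCongr (Equiv.refl _), fun c hc => ?_, fun p => rfl⟩⟩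
  · have hfst (p) : (σ p).1 = (σ (p.1, 0)).1 := fst_perm_eq_of_fst_eq hσ rfl
    have hsurj : Function.Surjective fun i => (σ (i, 0)).1 := fun i =>
      ⟨(σ.symm (i, 0)).1, by simp [← hfst]⟩
    exact ⟨Equiv.ofBijective _ (Finite.surjective_iff_bijective.1 hsurj), hfst⟩
  · obtain ⟨a, w, h⟩ := mem_codeD_iff.1 hc
    exact mem_codeD_iff.2 ⟨a ∘ π, w, fun p => h _⟩
end
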